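/- arXiv:2208.07586 — 3 statements merged into one kernel-verified Lean document; each statement's English description precedes it below -/
import Mathlib

section
/- Let r₁, r₂, m be integers with 0 < r₁ < r₂ < m. There exists at most one pair of sets (C, D) with 0 ∈ C such that C ∪ D = ℕ, C ∩ D = (r₁ + mℕ) ∪ (r₂ + mℕ), and R_C(n) = R_D(n) for all n ∈ ℕ; that is, if (C, D) and (C', D') are two such pairs with 0 ∈ C and 0 ∈ C', then C = C' and D = D'. -/
/-- `R S n` is the number of pairs `(s, s')` with `s, s' ∈ S`, `s < s'` and `s + s' = n`. -/
noncomputable def R (S : Set ℕ) (n : ℕ) : ℕ :=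
  Set.ncard {p : ℕ × ℕ | p.1 ∈ S ∧ p.2 ∈ S ∧ p.1 < p.2 ∧ p.1 + p.2 = n}

/-- `AP r m` is the arithmetic progression `r + mℕ = {r + m*k : k ∈ ℕ}`. -/
def AP (r m : ℕ) : Set ℕ := {n | ∃ k : ℕ, n = r + m * k}

theorem finite_pairs (S : Set ℕ) (n : ℕ) :
    {p : ℕ × ℕ | p.1 ∈ S ∧ p.2 ∈ S ∧ p.1 < p.2 ∧ p.1 + p.2 = n}.Finite :=
  ((Set.finite_Iic n).prod (Set.finite_Iic n)).subset fun p hp => by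
    obtain ⟨-, -, -, h⟩ := hp
    simp only [Set.mem_prod, Set.mem_Iic]
    omega

theorem R_congr_of_zero_notMem {S T : Set ℕ} {n : ℕ} (hS : 0 ∉ S) (hT : 0 ∉ T)
    (h : ∀ k < n, k ∈ S ↔ k ∈ T) : R S n = R T n := by
  unfold R
  congr 1
  ext ⟨a, b⟩
  simp only [Set.mem_ofPred_eq]
  by_cases ha : a = 0
  · subst ha; simp [hS, hT]
  · by_cases hab : a < b ∧ a + b = n
    · rw [h a (by omega), h b (by omega)]
    · tauto

theorem R_lt_of_mem_of_notMem {S T : Set ℕ} {n : ℕ} (hn : 0 < n) (hS : 0 ∈ S)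
    (h : ∀ k < n, k ∈ S ↔ k ∈ T) (hnS : n ∈ S) (hnT : n ∉ T) : R T n < R S n := by
  refine Set.ncard_lt_ncard ⟨?_, fun hsub => ?_⟩ (finite_pairs S n)
  · rintro ⟨a, b⟩ ⟨ha, hb, hab, hsum⟩
    dsimp only at ha hb hab hsum
    have hbn : b ≠ n := fun e => hnT (e ▸ hb)
    exact ⟨(h a (by omega)).2 ha, (h b (by omega)).2 hb, hab, hsum⟩
  · exact hnT (hsub (show ((0, n) : ℕ × ℕ) ∈ _ from ⟨hS, hnS, hn, zero_add n⟩)).2.1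

theorem mem_right_iff_of_union_inter {α : Type*} {C D I : Set α} (hU : C ∪ D = Set.univ)
    (hI : C ∩ D = I) (x : α) : x ∈ D ↔ x ∉ C ∨ x ∈ I := by
  have hx : x ∈ C ∪ D := hU ▸ Set.mem_univ x
  rw [← hI]
  simp only [Set.mem_union, Set.mem_inter_iff] at hx ⊢
  tauto

/-- Two sets whose intersection avoids `0`, whose union is `ℕ`, and whose representation
functions agree are determined by their intersection and by which of them contains `0`. -/
theorem eq_of_R_eq_of_inter_eq {C D C' D' I : Set ℕ} (hI0 : 0 ∉ I) (h0 : 0 ∈ C) (h0' : 0 ∈ C')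
    (hU : C ∪ D = Set.univ) (hI : C ∩ D = I) (hR : ∀ n : ℕ, R C n = R D n)
    (hU' : C' ∪ D' = Set.univ) (hI' : C' ∩ D' = I) (hR' : ∀ n : ℕ, R C' n = R D' n) :
    C = C' ∧ D = D' := by
  have hD := mem_right_iff_of_union_inter hU hI
  have hD' := mem_right_iff_of_union_inter hU' hI'
  have hC : ∀ n, n ∈ C ↔ n ∈ C' := by
    intro n
    induction n using Nat.strong_induction_on with
    | _ n ih =>
      rcases Nat.eq_zero_or_pos n with rfl | hn
      · exact iff_of_true h0 h0'
      have hRD : R D n = R D' n :=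
        R_congr_of_zero_notMem (by simp [hD, h0, hI0]) (by simp [hD', h0', hI0])
          fun k hk => by rw [hD, hD', ih k hk]
      have hRC : R C n = R C' n := by rw [hR, hR', hRD]
      by_contra hne
      by_cases hnC : n ∈ C
      · exact (R_lt_of_mem_of_notMem hn h0 ih hnC (by tauto)).ne' hRC
      · exact (R_lt_of_mem_of_notMem hn h0' (fun k hk => (ih k hk).symm) (by tauto) hnC).ne hRC
  exact ⟨Set.ext hC, Set.ext fun n => by rw [hD, hD', hC]⟩

theorem stmt_4 (r₁ r₂ m : ℕ) (h₁ : 0 < r₁) (h₂ : r₁ < r₂) (h₃ : r₂ < m)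
    (C D C' D' : Set ℕ) (h0 : 0 ∈ C) (h0' : 0 ∈ C')
    (hU : C ∪ D = Set.univ) (hI : C ∩ D = AP r₁ m ∪ AP r₂ m)
    (hR : ∀ n : ℕ, R C n = R D n)
    (hU' : C' ∪ D' = Set.univ) (hI' : C' ∩ D' = AP r₁ m ∪ AP r₂ m)
    (hR' : ∀ n : ℕ, R C' n = R D' n) :
    C = C' ∧ D = D' := by
  refine eq_of_R_eq_of_inter_eq ?_ h0 h0' hU hI hR hU' hI' hR'
  rintro (⟨k, hk⟩ | ⟨k, hk⟩) <;> omega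
end

section
/- Let r₁, r₂, m be integers with 0 < r₁ < r₂ < r₁ + r₂ ≤ m and r₁ even. Let C and D be sets of nonnegative integers such that C ∪ D = [0, m], C ∩ D = {r₁, r₂}, and 0 ∈ C. If R_C(n) = R_D(n) for every integer n ∈ [0, m], then there exists a positive integer l such that r₁ = 2^(2l+1) − 2 and r₂ = 2^(2l+1) − 1. -/
/-- The `±1`-valued Thue–Morse sequence, extended by `0` to the negative integers. -/
def thueMorse (z : ℤ) : ℤ := if 0 ≤ z then (-1) ^ (Nat.digits 2 z.toNat).sum else 0

namespace thueMorse

lemma of_neg {z : ℤ} (hz : z < 0) : thueMorse z = 0 := by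
  rw [thueMorse, if_neg (by omega)]

lemma zero : thueMorse 0 = 1 := by simp [thueMorse]

lemma two_mul (z : ℤ) : thueMorse (2 * z) = thueMorse z := by
  rcases lt_or_ge z 0 with hz | hz
  · rw [of_neg hz, of_neg (by omega)]
  · lift z to ℕ using hz
    rcases Nat.eq_zero_or_pos z with rfl | hz
    · simp
    · have h : Nat.digits 2 (2 * z) = 0 :: Nat.digits 2 z := by
        simpa using Nat.digits_add 2 one_lt_two 0 z (by omega) (Or.inr hz.ne')
      have h' : ((2 : ℤ) * z).toNat = 2 * z := by omega
      simp [thueMorse, h, h']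

lemma two_mul_add_one (z : ℤ) : thueMorse (2 * z + 1) = -thueMorse z := by
  rcases lt_or_ge z 0 with hz | hz
  · rw [of_neg hz, of_neg (by omega), neg_zero]
  · lift z to ℕ using hz
    have h : Nat.digits 2 (2 * z + 1) = 1 :: Nat.digits 2 z := by
      simpa [add_comm] using Nat.digits_add 2 one_lt_two 1 z (by omega) (Or.inl one_ne_zero)
    have h' : ((2 : ℤ) * z + 1).toNat = 2 * z + 1 := by omega
    have h'' : (0 : ℤ) ≤ 2 * z + 1 := by omega
    rw [thueMorse, if_pos h'', h', h]
    simp [thueMorse, pow_add]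

lemma eq_or {z : ℤ} (hz : 0 ≤ z) : thueMorse z = 1 ∨ thueMorse z = -1 := by
  rw [thueMorse, if_pos hz]
  exact neg_one_pow_eq_or ℤ _

lemma one : thueMorse 1 = -1 := by
  simpa [zero] using two_mul_add_one 0

lemma two_pow_mul (e : ℕ) (z : ℤ) : thueMorse (2 ^ e * z) = thueMorse z := by
  induction e with
  | zero => simp
  | succ e ih => rw [pow_succ', mul_assoc, two_mul, ih]

lemma two_pow (e : ℕ) : thueMorse (2 ^ e) = -1 := by
  simpa [one] using two_pow_mul e 1

lemma two_pow_sub_one (e : ℕ) : thueMorse (2 ^ e - 1) = (-1) ^ e := by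
  induction e with
  | zero => simp [zero]
  | succ e ih =>
    rw [show (2 : ℤ) ^ (e + 1) - 1 = 2 * (2 ^ e - 1) + 1 by ring, two_mul_add_one, ih]
    ring

lemma exists_ne_of_odd (g σ : ℤ) (hg : 0 ≤ g) :
    ∃ i, 0 ≤ i ∧ i ≤ 2 ∧ thueMorse (2 * g + 1 + i) ≠ σ * thueMorse i := by
  by_contra! h
  have h0 := h 0 le_rfl (by norm_num)
  have h1 := h 1 (by norm_num) (by norm_num)
  have h2 := h 2 (by norm_num) le_rfl
  rw [add_zero, two_mul_add_one, zero] at h0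
  rw [show 2 * g + 1 + 1 = 2 * (g + 1) by ring, two_mul, one] at h1
  rw [show 2 * g + 1 + 2 = 2 * (g + 1) + 1 by ring, two_mul_add_one,
    show (2 : ℤ) = 2 * 1 by ring, two_mul, one] at h2
  have := eq_or hg
  omega

lemma exists_ne_of_even {a σ i : ℤ} (h : thueMorse (a + i) ≠ σ * thueMorse i) :
    thueMorse (2 * a + 2 * i) ≠ σ * thueMorse (2 * i) := by
  rwa [← mul_add, two_mul, two_mul]

/-- A shift by `a < 2 ^ v` cannot act on an initial segment as multiplication by a scalar. -/
lemma exists_ne_of_lt (v : ℕ) : ∀ (a σ : ℤ), 0 < a → a < 2 ^ v →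
    ∃ i, 0 ≤ i ∧ 4 * (a + i) ≤ 5 * 2 ^ v ∧ thueMorse (a + i) ≠ σ * thueMorse i := by
  induction v with
  | zero => intro a σ h h'; omega
  | succ v ih =>
    intro a σ h h'
    rw [pow_succ] at h' ⊢
    rcases Int.even_or_odd' a with ⟨g, rfl | rfl⟩
    · obtain ⟨i, hi, hi', hne⟩ := ih g σ (by omega) (by omega)
      exact ⟨2 * i, by omega, by omega, exists_ne_of_even hne⟩
    · rcases Nat.eq_zero_or_pos v with rfl | hv
      · obtain rfl : g = 0 := by omega
        by_contra! H
        have h0 := H 0 le_rfl (by norm_num)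
        have h1 := H 1 (by norm_num) (by norm_num)
        have h2 := two_mul 1
        norm_num [zero, one] at h0 h1 h2
        omega
      · obtain ⟨w, rfl⟩ := Nat.exists_eq_add_of_le' hv
        have hw : (0 : ℤ) < 2 ^ w := by positivity
        rw [pow_succ] at h' ⊢
        obtain ⟨i, hi, hi', hne⟩ := exists_ne_of_odd g σ (by omega)
        exact ⟨i, hi, by omega, hne⟩

lemma exists_ne_of_two_pow_mul (e : ℕ) (c σ : ℤ) (hc : Odd c) (hc' : 0 < c) :
    ∃ i, 0 ≤ i ∧ i ≤ 2 * 2 ^ e ∧ thueMorse (2 ^ e * c + i) ≠ σ * thueMorse i := by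
  induction e with
  | zero =>
    obtain ⟨g, rfl⟩ := hc
    simpa using exists_ne_of_odd g σ (by omega)
  | succ e ih =>
    obtain ⟨i, hi, hi', hne⟩ := ih
    refine ⟨2 * i, by omega, by rw [pow_succ]; omega, ?_⟩
    rw [pow_succ', mul_assoc]
    exact exists_ne_of_even hne

end thueMorse

/-- Write `a > 0` as a power of two times an odd number. -/
lemma Int.exists_eq_two_pow_mul {a : ℤ} (ha : 0 < a) :
    ∃ (e : ℕ) (c : ℤ), Odd c ∧ 0 < c ∧ a = 2 ^ e * c := by
  lift a to ℕ using ha.le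
  obtain ⟨e, c, hc, rfl⟩ := Nat.exists_eq_two_pow_mul_odd (n := a) (by omega)
  exact ⟨e, c, by exact_mod_cast hc, by exact_mod_cast hc.pos, by push_cast; ring⟩

/-- The constraints on `r₁ = 2 * s` and `r₂ = 2 * s + d` that are expressed by the Thue–Morse
sequence alone. -/
structure ThueMorseConstraints (s d : ℤ) : Prop where
  s_pos : 0 < s
  d_pos : 0 < d
  apply_s : thueMorse s = 1
  odd : ∀ i, 0 ≤ i → i < s → 2 * i + 1 ≠ d →
    -thueMorse (s + i) + 2 * thueMorse i - thueMorse (2 * i + 1 - d) + thueMorse (2 * i - d) = 1 ∨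
    -thueMorse (s + i) + 2 * thueMorse i - thueMorse (2 * i + 1 - d) + thueMorse (2 * i - d) = -1
  even : ∀ i, 0 < i → i < s → 2 * i ≠ d →
    thueMorse (s + i) - thueMorse i - thueMorse (i - 1) - thueMorse (2 * i - d)
      + thueMorse (2 * i - 1 - d) = 1 ∨
    thueMorse (s + i) - thueMorse i - thueMorse (i - 1) - thueMorse (2 * i - d)
      + thueMorse (2 * i - 1 - d) = -1
  of_d_odd : ∀ a, d = 2 * a + 1 → a < s → -thueMorse (s + a) + 2 * thueMorse a = 1
  of_d_even : ∀ a, d = 2 * a → a < s → thueMorse (s - a) = 1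

namespace ThueMorseConstraints

open thueMorse

variable {s d : ℤ}

lemma exists_bound (h : ThueMorseConstraints s d) : ∃ (e : ℕ) (c : ℤ),
    Odd c ∧ 3 ≤ c ∧ s = 2 ^ e * c ∧ d ≤ 4 * 2 ^ e + 1 := by
  obtain ⟨e, c, hc, hc0, rfl⟩ := Int.exists_eq_two_pow_mul h.s_pos
  have hP : (0 : ℤ) < 2 ^ e := by positivity
  have hc3 : 3 ≤ c := by
    by_contra hlt
    obtain rfl : c = 1 := by obtain ⟨g, rfl⟩ := hc; omega
    have := h.apply_s
    rw [mul_one, two_pow] at this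
    omega
  refine ⟨e, c, hc, hc3, rfl, ?_⟩
  by_contra! hd
  obtain ⟨i, hi, hi', hne⟩ := exists_ne_of_two_pow_mul e c 1 hc hc0
  have hlt : i < 2 ^ e * c := by nlinarith
  have := h.odd i hi hlt (by omega)
  rw [of_neg (show 2 * i + 1 - d < 0 by omega), of_neg (show 2 * i - d < 0 by omega)] at this
  have := eq_or hi
  have := eq_or (show 0 ≤ 2 ^ e * c + i by omega)
  omega

lemma d_ne_even (h : ThueMorseConstraints s d) (a : ℤ) : d ≠ 2 * a := by
  rintro rfl
  have ha : 0 < a := by have := h.d_pos; omega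
  obtain ⟨e, c, hc, hc3, hs, hd⟩ := h.exists_bound
  have hP : (0 : ℤ) < 2 ^ e := by positivity
  have hsP : 3 * 2 ^ e ≤ s := by nlinarith
  have key : ∀ i, 0 ≤ i → i + a < s → thueMorse (a + i) = -1 * thueMorse i := by
    intro i hi his
    have := h.odd (a + i) (by omega) (by omega) (by omega)
    rw [show 2 * (a + i) + 1 - 2 * a = 2 * i + 1 by ring, two_mul_add_one,
      show 2 * (a + i) - 2 * a = 2 * i by ring, thueMorse.two_mul] at this
    have := eq_or hi
    have := eq_or (show 0 ≤ a + i by omega)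
    have := eq_or (show 0 ≤ s + (a + i) by omega)
    omega
  rcases lt_or_ge a (2 ^ (e + 1)) with hlt | hge
  · obtain ⟨i, hi, hi', hne⟩ := exists_ne_of_lt (e + 1) a (-1) ha hlt
    rw [pow_succ] at hi'
    exact hne (key i hi (by omega))
  · rw [pow_succ] at hge
    obtain rfl : a = 2 * 2 ^ e := by omega
    rcases eq_or_ne c 3 with rfl | hc'
    · have := h.of_d_even _ rfl (by omega)
      rw [show s - 2 * 2 ^ e = 2 ^ e by omega, two_pow] at this
      omega
    · have hc5 : 5 ≤ c := by obtain ⟨g, rfl⟩ := hc; omega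
      have := key (2 * 2 ^ e) (by omega) (by nlinarith)
      rw [← _root_.two_mul, thueMorse.two_mul, thueMorse.two_mul, two_pow] at this
      omega

lemma d_eq_one (h : ThueMorseConstraints s d) : d = 1 := by
  obtain ⟨e, c, hc, hc3, hs, hd⟩ := h.exists_bound
  have hP : (0 : ℤ) < 2 ^ e := by positivity
  have hsP : 3 * 2 ^ e ≤ s := by nlinarith
  obtain ⟨a, ha | rfl⟩ := Int.even_or_odd' d
  · exact absurd ha (h.d_ne_even a)
  by_contra hd1
  have ha : 0 < a := by have := h.d_pos; omega
  have hP' : (2 : ℤ) ^ e = 1 ∨ (2 : ℤ) ^ e = 2 ∨ 4 ∣ (2 : ℤ) ^ e := by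
    rcases e with _ | _ | e
    · simp
    · simp
    · exact Or.inr (Or.inr ⟨2 ^ e, by ring⟩)
  have hTa : thueMorse a = 1 := by
    have := h.of_d_odd a rfl (by omega)
    have := eq_or ha.le
    have := eq_or (show 0 ≤ s + a by omega)
    omega
  have hodd : ∀ i, a + 1 ≤ i → i < s →
      (thueMorse (i - a) = thueMorse (i - a - 1) → thueMorse i = thueMorse (i - a - 1)) ∧
      (thueMorse (i - a) ≠ thueMorse (i - a - 1) → thueMorse (s + i) = thueMorse i) := by
    intro i hi his
    have := h.odd i (by omega) his (by omega)
    rw [show 2 * i + 1 - (2 * a + 1) = 2 * (i - a) by ring, thueMorse.two_mul,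
      show 2 * i - (2 * a + 1) = 2 * (i - a - 1) + 1 by ring, two_mul_add_one] at this
    have := eq_or (show 0 ≤ s + i by omega)
    have := eq_or (show 0 ≤ i by omega)
    have := eq_or (show 0 ≤ i - a by omega)
    have := eq_or (show 0 ≤ i - a - 1 by omega)
    omega
  have heven : ∀ i, a + 1 ≤ i → i < s → thueMorse i ≠ thueMorse (i - 1) →
      thueMorse (s + i) = -thueMorse (i - a - 1) := by
    intro i hi his
    have := h.even i (by omega) his (by omega)
    rw [show 2 * i - (2 * a + 1) = 2 * (i - a - 1) + 1 by ring, two_mul_add_one,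
      show 2 * i - 1 - (2 * a + 1) = 2 * (i - a - 1) by ring, thueMorse.two_mul] at this
    have := eq_or (show 0 ≤ s + i by omega)
    have := eq_or (show 0 ≤ i by omega)
    have := eq_or (show 0 ≤ i - 1 by omega)
    have := eq_or (show 0 ≤ i - a - 1 by omega)
    omega
  obtain ⟨b, rfl | rfl⟩ := Int.even_or_odd' a
  · have key : ∀ i, 0 ≤ i → 2 * (b + i) + 1 < s → thueMorse (b + i) = 1 * thueMorse i := by
      intro i hi his
      have h1 := hodd (2 * (b + i) + 1) (by omega) his
      have h2 := heven (2 * (b + i) + 1) (by omega) his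
      rw [add_sub_cancel_right, thueMorse.two_mul, two_mul_add_one] at h2
      rw [show 2 * (b + i) + 1 - 2 * b = 2 * i + 1 by ring, add_sub_cancel_right,
        thueMorse.two_mul, two_mul_add_one, two_mul_add_one] at h1
      rw [show 2 * (b + i) + 1 - 2 * b - 1 = 2 * i by ring, thueMorse.two_mul] at h2
      have := eq_or hi
      have := eq_or (show 0 ≤ b + i by omega)
      omega
    rcases lt_or_ge b (2 ^ e) with hlt | hge
    · obtain ⟨i, hi, hi', hne⟩ := exists_ne_of_lt e b 1 (by omega) hlt
      exact hne (key i hi (by omega))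
    · obtain rfl : b = 2 ^ e := by omega
      rw [thueMorse.two_mul, two_pow] at hTa
      omega
  · have key : ∀ q, 0 ≤ q → 4 * q + 2 * (b + 1) + 1 < s →
        thueMorse (2 * q + (b + 1)) = thueMorse q := by
      intro q hq hqs
      have h1 := (hodd (2 * (2 * q + (b + 1)) + 1) (by omega) (by omega)).1
      rw [show 2 * (2 * q + (b + 1)) + 1 - (2 * b + 1) - 1 = 2 * (2 * q) + 1 by ring,
        show 2 * (2 * q + (b + 1)) + 1 - (2 * b + 1) = 2 * (2 * q + 1) by ring] at h1
      rw [thueMorse.two_mul, two_mul_add_one, two_mul_add_one, two_mul_add_one,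
        thueMorse.two_mul] at h1
      omega
    rcases e with _ | e
    · obtain rfl : b = 0 := by omega
      rw [mul_zero, zero_add, one] at hTa
      omega
    have hQ : (0 : ℤ) < 2 ^ e := by positivity
    rw [pow_succ] at *
    obtain ⟨g, hg | hg⟩ := Int.even_or_odd' (b + 1)
    · have key' : ∀ q, 0 ≤ q → 4 * (g + q) + 1 < s → thueMorse (g + q) = 1 * thueMorse q := by
        intro q hq hqs
        have := key q hq (by omega)
        rwa [hg, ← mul_add, thueMorse.two_mul, add_comm q g, ← one_mul (thueMorse q)] at this
      rcases lt_or_ge g (2 ^ e) with hlt | hge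
      · obtain ⟨q, hq, hq', hne⟩ := exists_ne_of_lt e g 1 (by omega) hlt
        exact hne (key' q hq (by omega))
      · obtain rfl : g = 2 ^ e := by omega
        have := key' 0 le_rfl (by omega)
        rw [add_zero, zero, two_pow] at this
        omega
    · obtain rfl : b = 2 * g := by omega
      have hg0 : g ≠ 0 := by
        rintro rfl
        rw [mul_zero, mul_zero, zero_add, one] at hTa
        omega
      obtain ⟨q, hq, hq', hne⟩ := exists_ne_of_lt e g (-1) (by omega) (by omega)
      have := key q hq (by omega)
      rw [show 2 * q + (2 * g + 1) = 2 * (g + q) + 1 by ring, two_mul_add_one] at this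
      exact hne (by omega)

lemma exists_eq_two_pow (h : ThueMorseConstraints s d) :
    ∃ l : ℕ, 0 < l ∧ 2 * s = 2 ^ (2 * l + 1) - 2 := by
  obtain rfl := h.d_eq_one
  have hodd : ∀ j, 0 < j → j < s → thueMorse j ≠ thueMorse (j - 1) →
      thueMorse (s + j) = thueMorse j := by
    intro j hj hjs
    have := h.odd j hj.le hjs (by omega)
    rw [add_sub_cancel_right, thueMorse.two_mul, show 2 * j - 1 = 2 * (j - 1) + 1 by ring,
      two_mul_add_one] at this
    have := eq_or hj.le
    have := eq_or (show 0 ≤ s + j by omega)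
    have := eq_or (show 0 ≤ j - 1 by omega)
    omega
  have hodd' : ∀ i, 0 ≤ i → 2 * i + 1 < s → thueMorse (s + (2 * i + 1)) = -thueMorse i := by
    intro i hi his
    have := hodd (2 * i + 1) (by omega) his
    rw [add_sub_cancel_right, thueMorse.two_mul, two_mul_add_one] at this
    have := eq_or hi
    omega
  have hTs := h.apply_s
  have hs := h.s_pos
  obtain ⟨u, rfl | rfl⟩ := Int.even_or_odd' s
  · rw [thueMorse.two_mul] at hTs
    obtain ⟨e, c, hc, hc0, rfl⟩ := Int.exists_eq_two_pow_mul (show 0 < u by omega)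
    have hP : (0 : ℤ) < 2 ^ e := by positivity
    have hc3 : c ≠ 1 := by
      rintro rfl
      rw [mul_one, two_pow] at hTs
      omega
    have hc3 : 3 ≤ c := by obtain ⟨g, rfl⟩ := hc; omega
    have hlt : 3 * 2 ^ e ≤ 2 ^ e * c := by nlinarith
    obtain ⟨i, hi, hi', hne⟩ := exists_ne_of_two_pow_mul e c 1 hc hc0
    have := hodd' i hi (by omega)
    rw [show 2 * (2 ^ e * c) + (2 * i + 1) = 2 * (2 ^ e * c + i) + 1 by ring,
      two_mul_add_one] at this
    omega
  · rw [two_mul_add_one] at hTs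
    have hu : u ≠ 0 := by
      rintro rfl
      rw [zero] at hTs
      omega
    obtain ⟨e, c, hc, hc0, hw⟩ := Int.exists_eq_two_pow_mul (show 0 < u + 1 by omega)
    have hP : (0 : ℤ) < 2 ^ e := by positivity
    have key : ∀ i, 0 ≤ i → i < u → thueMorse (u + 1 + i) = -1 * thueMorse i := by
      intro i hi hiu
      have := hodd' i hi (by omega)
      rw [show 2 * u + 1 + (2 * i + 1) = 2 * (u + 1 + i) by ring, thueMorse.two_mul] at this
      omega
    rcases eq_or_ne c 1 with rfl | hc1
    · obtain rfl : u = 2 ^ e - 1 := by omega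
      rw [two_pow_sub_one] at hTs
      rcases Nat.even_or_odd' e with ⟨l, rfl | rfl⟩
      · simp at hTs
      · exact ⟨l + 1, by omega, by ring⟩
    · exfalso
      rcases eq_or_ne c 3 with rfl | hc3
      · have := key 0 le_rfl (by omega)
        rw [add_zero, hw, two_pow_mul, show (3 : ℤ) = 2 * 1 + 1 by ring, two_mul_add_one, one,
          zero] at this
        omega
      · have hc5 : 5 ≤ c := by obtain ⟨g, rfl⟩ := hc; omega
        have hlt : 5 * 2 ^ e ≤ 2 ^ e * c := by nlinarith
        obtain ⟨i, hi, hi', hne⟩ := exists_ne_of_two_pow_mul e c (-1) hc hc0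
        have := key i hi (by omega)
        rw [hw] at this
        exact hne this

end ThueMorseConstraints

/-- The recurrence, compared coefficientwise, that a function with generating series `f` satisfies
if `f(x) * (1 + (1 - x) * (x ^ r₁ + x ^ r₂)) = (1 - x) * f(x ^ 2)` up to degree `m`. -/
structure SatisfiesRecurrence (F : ℤ → ℤ) (r₁ r₂ m : ℤ) : Prop where
  of_neg : ∀ z < 0, F z = 0
  zero : F 0 = 1
  even : ∀ n, 2 * n ≤ m →
    F (2 * n) = F n - F (2 * n - r₁) + F (2 * n - 1 - r₁) - F (2 * n - r₂) + F (2 * n - 1 - r₂)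
  odd : ∀ n, 2 * n + 1 ≤ m →
    F (2 * n + 1) = -F n - F (2 * n + 1 - r₁) + F (2 * n - r₁) - F (2 * n + 1 - r₂) + F (2 * n - r₂)

namespace SatisfiesRecurrence

variable {F : ℤ → ℤ}

lemma eq_thueMorse {r₁ r₂ m : ℤ} (hF : SatisfiesRecurrence F r₁ r₂ m) (hr : r₁ < r₂) (hm : r₁ ≤ m)
    {z : ℤ} (hz : z < r₁) : F z = thueMorse z := by
  rcases lt_or_ge z 0 with hneg | hpos
  · rw [hF.of_neg z hneg, thueMorse.of_neg hneg]
  lift z to ℕ using hpos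
  induction z using Nat.strong_induction_on with
  | _ z ih =>
    rcases Nat.eq_zero_or_pos z with rfl | hz0
    · rw [Nat.cast_zero, hF.zero, thueMorse.zero]
    obtain ⟨k, rfl | rfl⟩ := Nat.even_or_odd' z
    · push_cast at hz ⊢
      rw [hF.even k (by omega), thueMorse.two_mul, ih k (by omega) (by omega),
        hF.of_neg _ (by omega), hF.of_neg _ (by omega), hF.of_neg _ (by omega),
        hF.of_neg _ (by omega)]
      ring
    · push_cast at hz ⊢
      rw [hF.odd k (by omega), thueMorse.two_mul_add_one, ih k (by omega) (by omega),
        hF.of_neg _ (by omega), hF.of_neg _ (by omega), hF.of_neg _ (by omega),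
        hF.of_neg _ (by omega)]
      ring

lemma thueMorseConstraints {s d m : ℤ} (hF : SatisfiesRecurrence F (2 * s) (2 * s + d) m)
    (hs : 0 < s) (hd : 0 < d) (hm : 4 * s + d ≤ m)
    (hpm : ∀ z, 0 ≤ z → z ≤ m → z ≠ 2 * s → z ≠ 2 * s + d → F z = 1 ∨ F z = -1)
    (h₁ : F (2 * s) = 0) (h₂ : F (2 * s + d) = 0) : ThueMorseConstraints s d := by
  have hT : ∀ z, z < 2 * s → F z = thueMorse z := fun z hz ↦
    hF.eq_thueMorse (by omega) (by omega) hz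
  have hTs : thueMorse s = 1 := by
    have := hF.even s (by omega)
    rw [sub_self, hF.zero, hF.of_neg (2 * s - 1 - 2 * s) (by omega),
      hF.of_neg (2 * s - (2 * s + d)) (by omega), hF.of_neg (2 * s - 1 - (2 * s + d)) (by omega),
      hT s (by omega)] at this
    omega
  have hodd : ∀ i, 0 ≤ i → i < s → F (2 * (s + i) + 1) = -thueMorse (s + i) + 2 * thueMorse i
      - thueMorse (2 * i + 1 - d) + thueMorse (2 * i - d) := by
    intro i hi his
    rw [hF.odd (s + i) (by omega), hT (s + i) (by omega),
      show 2 * (s + i) + 1 - 2 * s = 2 * i + 1 by ring, show 2 * (s + i) - 2 * s = 2 * i by ring,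
      show 2 * (s + i) + 1 - (2 * s + d) = 2 * i + 1 - d by ring,
      show 2 * (s + i) - (2 * s + d) = 2 * i - d by ring, hT (2 * i + 1) (by omega),
      hT (2 * i) (by omega), hT (2 * i + 1 - d) (by omega), hT (2 * i - d) (by omega),
      thueMorse.two_mul, thueMorse.two_mul_add_one]
    ring
  refine ⟨hs, hd, hTs, ?_, ?_, ?_, ?_⟩
  · intro i hi his hid
    rw [← hodd i hi his]
    exact hpm _ (by omega) (by omega) (by omega) (by omega)
  · intro i hi his hid
    have h := hpm (2 * (s + i)) (by omega) (by omega) (by omega) (by omega)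
    rw [hF.even (s + i) (by omega), hT (s + i) (by omega),
      show 2 * (s + i) - 2 * s = 2 * i by ring,
      show 2 * (s + i) - 1 - 2 * s = 2 * (i - 1) + 1 by ring,
      show 2 * (s + i) - (2 * s + d) = 2 * i - d by ring,
      show 2 * (s + i) - 1 - (2 * s + d) = 2 * i - 1 - d by ring, hT (2 * (i - 1) + 1) (by omega),
      hT (2 * i) (by omega), hT (2 * i - d) (by omega), hT (2 * i - 1 - d) (by omega),
      thueMorse.two_mul, thueMorse.two_mul_add_one] at h
    omega
  · rintro a rfl has
    have h := hodd a (by omega) has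
    rw [show 2 * (s + a) + 1 = 2 * s + (2 * a + 1) by ring, h₂, sub_self, thueMorse.zero,
      thueMorse.of_neg (show 2 * a - (2 * a + 1) < 0 by omega)] at h
    omega
  · rintro a rfl has
    have h1 := hodd 0 le_rfl hs
    rw [add_zero, hTs, thueMorse.zero, thueMorse.of_neg (show 2 * 0 + 1 - 2 * a < 0 by omega),
      thueMorse.of_neg (show 2 * 0 - 2 * a < 0 by omega)] at h1
    have h := hpm (2 * (2 * s) + 1) (by omega) (by omega) (by omega) (by omega)
    rw [hF.odd (2 * s) (by omega), h₁, show 2 * (2 * s) + 1 - 2 * s = 2 * s + 1 by ring, h1,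
      show 2 * (2 * s) - 2 * s = 2 * s by ring, h₁,
      show 2 * (2 * s) + 1 - (2 * s + 2 * a) = 2 * (s - a) + 1 by ring,
      show 2 * (2 * s) - (2 * s + 2 * a) = 2 * (s - a) by ring, hT (2 * (s - a) + 1) (by omega),
      hT (2 * (s - a)) (by omega), thueMorse.two_mul, thueMorse.two_mul_add_one] at h
    have := thueMorse.eq_or (show 0 ≤ s - a by omega)
    omega

end SatisfiesRecurrence

section

open Finset

lemma sum_antidiagonal_ite_fst_eq_snd_two_mul {M : Type*} [AddCommMonoid M] (g : ℕ → M) (k : ℕ) :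
    ∑ p ∈ antidiagonal (2 * k), (if p.1 = p.2 then g p.1 else 0) = g k := by
  rw [Finset.sum_eq_single (k, k)]
  · simp
  · rintro ⟨a, b⟩ hab hne
    rw [HasAntidiagonal.mem_antidiagonal] at hab
    refine if_neg fun h ↦ hne ?_
    rw [Prod.mk.injEq]
    omega
  · intro h
    exact absurd (by rw [HasAntidiagonal.mem_antidiagonal]; ring) h

lemma sum_antidiagonal_ite_fst_eq_snd_two_mul_add_one {M : Type*} [AddCommMonoid M]
    (g : ℕ → M) (k : ℕ) :
    ∑ p ∈ antidiagonal (2 * k + 1), (if p.1 = p.2 then g p.1 else 0) = 0 := by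
  refine Finset.sum_eq_zero fun p hp ↦ if_neg fun h ↦ ?_
  rw [HasAntidiagonal.mem_antidiagonal] at hp
  omega

open Classical in
lemma R_eq_sum (S : Set ℕ) (n : ℕ) :
    (R S n : ℤ) = ∑ p ∈ antidiagonal n,
      if p.1 < p.2 then S.indicator 1 p.1 * S.indicator (1 : ℕ → ℤ) p.2 else 0 := by
  have h : {p : ℕ × ℕ | p.1 ∈ S ∧ p.2 ∈ S ∧ p.1 < p.2 ∧ p.1 + p.2 = n} =
      ((antidiagonal n).filter fun p ↦ p.1 < p.2 ∧ p.1 ∈ S ∧ p.2 ∈ S : Finset (ℕ × ℕ)) := by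
    ext p
    simp only [Set.mem_ofPred_eq, coe_filter, HasAntidiagonal.mem_antidiagonal]
    tauto
  rw [R, h, Set.ncard_coe_finset, card_filter, Nat.cast_sum]
  refine Finset.sum_congr rfl fun p _ ↦ ?_
  by_cases h1 : p.1 < p.2 <;> by_cases h2 : p.1 ∈ S <;> by_cases h3 : p.2 ∈ S <;> simp [h1, h2, h3]

lemma sum_antidiagonal_indicator (S : Set ℕ) (n : ℕ) :
    ∑ p ∈ antidiagonal n, S.indicator 1 p.1 * S.indicator (1 : ℕ → ℤ) p.2 =
      2 * R S n + ∑ p ∈ antidiagonal n, if p.1 = p.2 then S.indicator 1 p.1 else 0 := by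
  have hswap : (R S n : ℤ) = ∑ p ∈ antidiagonal n,
      if p.2 < p.1 then S.indicator 1 p.1 * S.indicator (1 : ℕ → ℤ) p.2 else 0 := by
    rw [R_eq_sum, ← Nat.sum_antidiagonal_swap]
    simp [mul_comm]
  rw [_root_.two_mul]
  nth_rw 1 [R_eq_sum]
  rw [hswap, ← sum_add_distrib, ← sum_add_distrib]
  refine Finset.sum_congr rfl fun p _ ↦ ?_
  rcases lt_trichotomy p.1 p.2 with h | h | h
  · simp [h, h.not_gt, h.ne]
  · by_cases h' : p.2 ∈ S <;> simp [h, h']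
  · simp [h, h.not_gt, h.ne']

/-- The difference of the indicator functions of `C` and `D`, extended by `0` to `ℤ`. -/
noncomputable def indicatorDiff (C D : Set ℕ) (z : ℤ) : ℤ :=
  if 0 ≤ z then C.indicator 1 z.toNat - D.indicator 1 z.toNat else 0

lemma indicatorDiff_natCast (C D : Set ℕ) (n : ℕ) :
    indicatorDiff C D n = C.indicator 1 n - D.indicator 1 n := by
  simp [indicatorDiff]

lemma indicatorDiff_of_neg (C D : Set ℕ) {z : ℤ} (hz : z < 0) : indicatorDiff C D z = 0 := by
  rw [indicatorDiff, if_neg (by omega)]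

lemma sum_antidiagonal_indicatorDiff_mul (C D : Set ℕ) (n r : ℕ) :
    ∑ p ∈ antidiagonal n, indicatorDiff C D p.1 * (if p.2 = r then 1 else 0) =
      indicatorDiff C D ((n : ℤ) - r) := by
  rcases lt_or_ge n r with h | h
  · rw [indicatorDiff_of_neg _ _ (by omega)]
    refine Finset.sum_eq_zero fun p hp ↦ ?_
    rw [HasAntidiagonal.mem_antidiagonal] at hp
    rw [if_neg (by omega), mul_zero]
  · rw [Finset.sum_eq_single (n - r, r)]
    · simp [h]
    · rintro ⟨a, b⟩ hab hne
      rw [HasAntidiagonal.mem_antidiagonal] at hab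
      rw [if_neg, mul_zero]
      rintro rfl
      exact hne (by rw [Prod.mk.injEq]; omega)
    · intro h'
      exact absurd (by rw [HasAntidiagonal.mem_antidiagonal]; omega) h'

lemma indicator_add_indicator {r₁ r₂ m : ℕ} {C D : Set ℕ} (h : r₁ < r₂)
    (hU : C ∪ D = Set.Icc 0 m) (hI : C ∩ D = {r₁, r₂}) {n : ℕ} (hn : n ≤ m) :
    C.indicator 1 n + D.indicator 1 n =
      1 + (if n = r₁ then 1 else 0) + (if n = r₂ then 1 else 0 : ℤ) := by
  have hu : n ∈ C ∪ D := by rw [hU]; simpa using hn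
  have hi : n ∈ C ∩ D ↔ n = r₁ ∨ n = r₂ := by rw [hI]; simp
  rw [Set.mem_inter_iff] at hi
  rw [Set.mem_union] at hu
  by_cases h1 : n ∈ C <;> by_cases h2 : n ∈ D <;> simp only [h1, h2, Set.indicator_of_mem,
    Set.indicator_of_notMem, not_false_eq_true, Pi.one_apply, and_true,
    and_false, true_iff, false_iff, false_or, or_false] at * <;> split_ifs <;> omega

lemma sum_range_indicatorDiff {r₁ r₂ m : ℕ} {C D : Set ℕ} (h : r₁ < r₂)
    (hU : C ∪ D = Set.Icc 0 m) (hI : C ∩ D = {r₁, r₂}) {n : ℕ} (hn : n ≤ m) (hR : R C n = R D n) :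
    ∑ i ∈ range (n + 1), indicatorDiff C D i + indicatorDiff C D ((n : ℤ) - r₁)
        + indicatorDiff C D ((n : ℤ) - r₂) =
      ∑ p ∈ antidiagonal n, if p.1 = p.2 then indicatorDiff C D p.1 else 0 := by
  have hC := sum_antidiagonal_indicator C n
  have hD := sum_antidiagonal_indicator D n
  have hcross : ∑ p ∈ antidiagonal n, C.indicator 1 p.1 * D.indicator (1 : ℕ → ℤ) p.2 =
      ∑ p ∈ antidiagonal n, D.indicator 1 p.1 * C.indicator (1 : ℕ → ℤ) p.2 := by
    rw [← Nat.sum_antidiagonal_swap]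
    simp [mul_comm]
  have hdiag : ∑ p ∈ antidiagonal n, (if p.1 = p.2 then indicatorDiff C D p.1 else 0) =
      ∑ p ∈ antidiagonal n, (if p.1 = p.2 then C.indicator 1 p.1 else 0) -
      ∑ p ∈ antidiagonal n, (if p.1 = p.2 then D.indicator 1 p.1 else 0) := by
    rw [← sum_sub_distrib]
    refine Finset.sum_congr rfl fun p _ ↦ ?_
    split_ifs <;> simp [indicatorDiff_natCast]
  have hprod : ∑ p ∈ antidiagonal n, indicatorDiff C D p.1 *
        (C.indicator 1 p.2 + D.indicator 1 p.2) =
      ∑ p ∈ antidiagonal n, C.indicator 1 p.1 * C.indicator (1 : ℕ → ℤ) p.2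
      + ∑ p ∈ antidiagonal n, C.indicator 1 p.1 * D.indicator (1 : ℕ → ℤ) p.2
      - ∑ p ∈ antidiagonal n, D.indicator 1 p.1 * C.indicator (1 : ℕ → ℤ) p.2
      - ∑ p ∈ antidiagonal n, D.indicator 1 p.1 * D.indicator (1 : ℕ → ℤ) p.2 := by
    rw [← sum_add_distrib, ← sum_sub_distrib, ← sum_sub_distrib]
    refine Finset.sum_congr rfl fun p _ ↦ ?_
    rw [indicatorDiff_natCast]
    ring
  have hprod' : ∑ p ∈ antidiagonal n, indicatorDiff C D p.1 *
        (C.indicator 1 p.2 + D.indicator 1 p.2) =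
      ∑ i ∈ range (n + 1), indicatorDiff C D i + indicatorDiff C D ((n : ℤ) - r₁)
        + indicatorDiff C D ((n : ℤ) - r₂) := by
    rw [← sum_antidiagonal_indicatorDiff_mul, ← sum_antidiagonal_indicatorDiff_mul,
      ← Nat.sum_antidiagonal_eq_sum_range_succ_mk (fun p : ℕ × ℕ ↦ indicatorDiff C D p.1) n,
      ← sum_add_distrib, ← sum_add_distrib]
    refine Finset.sum_congr rfl fun p hp ↦ ?_
    rw [HasAntidiagonal.mem_antidiagonal] at hp
    rw [indicator_add_indicator h hU hI (by omega)]
    ring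
  rw [hR] at hC
  linarith

lemma satisfiesRecurrence_indicatorDiff {r₁ r₂ m : ℕ} {C D : Set ℕ} (h₁ : 0 < r₁) (h₂ : r₁ < r₂)
    (hU : C ∪ D = Set.Icc 0 m) (hI : C ∩ D = {r₁, r₂}) (h0 : 0 ∈ C)
    (hR : ∀ n ≤ m, R C n = R D n) : SatisfiesRecurrence (indicatorDiff C D) r₁ r₂ m := by
  have hD : 0 ∉ D := fun hD ↦ by
    have : 0 ∈ C ∩ D := ⟨h0, hD⟩
    rw [hI] at this
    simp only [Set.mem_insert_iff, Set.mem_singleton_iff] at this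
    omega
  have hsum (n : ℕ) (hn : n ≤ m) := sum_range_indicatorDiff h₂ hU hI hn (hR n hn)
  refine ⟨fun z hz ↦ indicatorDiff_of_neg C D hz, by simp [indicatorDiff, h0, hD], ?_, ?_⟩
  · intro n hn
    rcases lt_trichotomy n 0 with hn0 | rfl | hn0
    · simp only [indicatorDiff_of_neg C D hn0, indicatorDiff_of_neg C D
        (show 2 * n < 0 by omega), indicatorDiff_of_neg C D (show 2 * n - r₁ < 0 by omega),
        indicatorDiff_of_neg C D (show 2 * n - 1 - r₁ < 0 by omega),
        indicatorDiff_of_neg C D (show 2 * n - r₂ < 0 by omega),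
        indicatorDiff_of_neg C D (show 2 * n - 1 - r₂ < 0 by omega)]
      ring
    · rw [indicatorDiff_of_neg C D (show 2 * 0 - (r₁ : ℤ) < 0 by omega),
        indicatorDiff_of_neg C D (show 2 * 0 - 1 - (r₁ : ℤ) < 0 by omega),
        indicatorDiff_of_neg C D (show 2 * 0 - (r₂ : ℤ) < 0 by omega),
        indicatorDiff_of_neg C D (show 2 * 0 - 1 - (r₂ : ℤ) < 0 by omega)]
      ring_nf
    · obtain ⟨k, rfl⟩ : ∃ k : ℕ, n = k + 1 := ⟨(n - 1).toNat, by omega⟩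
      have e1 := hsum (2 * k + 1) (by omega)
      have e2 := hsum (2 * (k + 1)) (by omega)
      rw [sum_antidiagonal_ite_fst_eq_snd_two_mul_add_one (fun i ↦ indicatorDiff C D i)] at e1
      rw [sum_antidiagonal_ite_fst_eq_snd_two_mul (fun i ↦ indicatorDiff C D i), sum_range_succ,
        show 2 * (k + 1) = 2 * k + 1 + 1 by ring] at e2
      push_cast at e1 e2
      rw [show (2 : ℤ) * (k + 1) = 2 * k + 1 + 1 by ring, add_sub_cancel_right]
      linarith
  · intro n hn
    rcases lt_or_ge n 0 with hn0 | hn0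
    · simp only [indicatorDiff_of_neg C D hn0, indicatorDiff_of_neg C D
        (show 2 * n + 1 < 0 by omega), indicatorDiff_of_neg C D (show 2 * n + 1 - r₁ < 0 by omega),
        indicatorDiff_of_neg C D (show 2 * n - r₁ < 0 by omega),
        indicatorDiff_of_neg C D (show 2 * n + 1 - r₂ < 0 by omega),
        indicatorDiff_of_neg C D (show 2 * n - r₂ < 0 by omega)]
      ring
    · lift n to ℕ using hn0
      have e1 := hsum (2 * n) (by omega)
      have e2 := hsum (2 * n + 1) (by omega)
      rw [sum_antidiagonal_ite_fst_eq_snd_two_mul (fun i ↦ indicatorDiff C D i)] at e1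
      rw [sum_antidiagonal_ite_fst_eq_snd_two_mul_add_one (fun i ↦ indicatorDiff C D i),
        sum_range_succ] at e2
      push_cast at e1 e2
      linarith

end

theorem stmt_5 (r₁ r₂ m : ℕ) (h₁ : 0 < r₁) (h₂ : r₁ < r₂) (h₃ : r₂ < r₁ + r₂)
    (h₄ : r₁ + r₂ ≤ m) (h₅ : Even r₁) (C D : Set ℕ)
    (hU : C ∪ D = Set.Icc 0 m) (hI : C ∩ D = {r₁, r₂}) (h0 : 0 ∈ C)
    (hR : ∀ n ≤ m, R C n = R D n) :
    ∃ l : ℕ, 0 < l ∧ r₁ = 2 ^ (2 * l + 1) - 2 ∧ r₂ = 2 ^ (2 * l + 1) - 1 := by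
  have hF := satisfiesRecurrence_indicatorDiff h₁ h₂ hU hI h0 hR
  have hmem {n : ℕ} (hn : n ≤ m) : (n ∈ C ∨ n ∈ D) ∧ (n ∈ C ∧ n ∈ D ↔ n = r₁ ∨ n = r₂) := by
    rw [← Set.mem_union, hU, ← Set.mem_inter_iff, hI]
    simpa using hn
  have hzero {n : ℕ} (hn : n = r₁ ∨ n = r₂) : indicatorDiff C D n = 0 := by
    obtain ⟨hC, hD⟩ := (hmem (n := n) (by omega)).2.2 hn
    simp [indicatorDiff_natCast, hC, hD]
  obtain ⟨s, hs⟩ := h₅.exists_two_nsmul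
  obtain ⟨d, rfl⟩ := Nat.exists_eq_add_of_lt h₂
  obtain rfl : r₁ = 2 * s := by simpa using hs
  have hcon : ThueMorseConstraints (s : ℤ) ((d : ℤ) + 1) := by
    have hr : ((2 * s + d + 1 : ℕ) : ℤ) = 2 * s + (d + 1) := by push_cast; ring
    have hr' : ((2 * s : ℕ) : ℤ) = 2 * s := by push_cast; ring
    rw [hr, hr'] at hF
    refine hF.thueMorseConstraints (by omega) (by omega) (by omega) ?_
      (hr' ▸ hzero (Or.inl rfl)) (hr ▸ hzero (Or.inr rfl))
    intro z hz hzm hz1 hz2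
    lift z to ℕ using hz
    rw [indicatorDiff_natCast]
    obtain ⟨hu, hi⟩ := hmem (n := z) (by omega)
    have hi' : ¬(z ∈ C ∧ z ∈ D) := by rw [hi]; omega
    by_cases hC : z ∈ C
    · simp [hC, show z ∉ D from fun hD ↦ hi' ⟨hC, hD⟩]
    · simp [hC, hu.resolve_left hC]
  have hd := hcon.d_eq_one
  obtain ⟨l, hl, hl'⟩ := hcon.exists_eq_two_pow
  have hl'' : 2 * s + 2 = 2 ^ (2 * l + 1) := by
    zify
    omega
  exact ⟨l, hl, by omega, by omega⟩
end

section
/- Let l be a positive integer and let E, F be sets of nonnegative integers with E ∪ F = [0, 3·2^(2l+1) − 4], 0 ∈ E, and E ∩ F = {2^(2l+1) − 2, 2^(2l+1) − 1}. Then R_E(n) = R_F(n) for every integer n ∈ [0, 3·2^(2l+1) − 4] if and only if E = A_{2l+1} ∪ (2^(2l+1) − 2 + B_{2l+1}) ∪ (2^(2l+2) − 2 + (B_{2l+1} ∩ [0, 2^(2l+1) − 3])) ∪ {3·2^(2l+1) − 4} and F = B_{2l+1} ∪ (2^(2l+1) − 2 + A_{2l+1}) ∪ (2^(2l+2) − 2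 + (A_{2l+1} ∩ [0, 2^(2l+1) − 3])). -/
/-- The Thue–Morse set: nonnegative integers with an even number of binary digits 1. -/
def TMA : Set ℕ := {n | Even ((Nat.digits 2 n).sum)}

/-- Complement of the Thue–Morse set. -/
def TMB : Set ℕ := {n | ¬ Even ((Nat.digits 2 n).sum)}

/-- `TMAl l = A ∩ [0, 2^l - 1]`. -/
def TMAl (l : ℕ) : Set ℕ := TMA ∩ Set.Icc 0 (2 ^ l - 1)

/-- `TMBl l = B ∩ [0, 2^l - 1]`. -/
def TMBl (l : ℕ) : Set ℕ := TMB ∩ Set.Icc 0 (2 ^ l - 1)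

/-- The set `E` of Claim 3. -/
def Eset (l : ℕ) : Set ℕ :=
  TMAl (2 * l + 1) ∪ ((fun x => 2 ^ (2 * l + 1) - 2 + x) '' TMBl (2 * l + 1)) ∪
    ((fun x => 2 ^ (2 * l + 2) - 2 + x) ''
      (TMBl (2 * l + 1) ∩ Set.Icc 0 (2 ^ (2 * l + 1) - 3))) ∪
    {3 * 2 ^ (2 * l + 1) - 4}

/-- The set `F` of Claim 3. -/
def Fset (l : ℕ) : Set ℕ :=
  TMBl (2 * l + 1) ∪ ((fun x => 2 ^ (2 * l + 1) - 2 + x) '' TMAl (2 * l + 1)) ∪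
    ((fun x => 2 ^ (2 * l + 2) - 2 + x) ''
      (TMAl (2 * l + 1) ∩ Set.Icc 0 (2 ^ (2 * l + 1) - 3)))

open scoped Classical in
/-- The integer-valued indicator function of `S`. -/
noncomputable def charFun (S : Set ℕ) (n : ℕ) : ℤ := if n ∈ S then 1 else 0

/-- The difference of the indicator functions of `E` and `F`. -/
noncomputable def charDiff (E F : Set ℕ) (n : ℕ) : ℤ := charFun E n - charFun F n

/-- The sequence `f` shifted to the right by `k`, padded with zeros. -/
def shiftSeq (k : ℕ) (f : ℕ → ℤ) (n : ℕ) : ℤ := if k ≤ n then f (n - k) else 0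

/-- The Thue–Morse sequence with values `±1`. -/
def tmSign (n : ℕ) : ℤ := (-1) ^ (Nat.digits 2 n).sum

/-- The difference of the indicator functions of `Eset l` and `Fset l` on `[0, 3N - 4]`,
where `N = 2 ^ (2l + 1)`. -/
def tmDiff (N n : ℕ) : ℤ :=
  if n < N - 2 then tmSign n
  else if n < N then 0
  else if n < 2 * N - 2 then -tmSign (n - (N - 2))
  else if n < 3 * N - 4 then -tmSign (n - (2 * N - 2))
  else 1

/-- The recurrence equivalent to equality of the representation functions of two sets with union
`[0, M]` and intersection `{a, a + 1}`. -/
def SignRec (a M : ℕ) (f : ℕ → ℤ) : Prop :=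
  ∀ n, 1 ≤ n → n ≤ M →
    f n + shiftSeq a f n - shiftSeq (a + 2) f n = (if Even n then 1 else -1) * f (n / 2)

lemma tmSign_zero : tmSign 0 = 1 := by simp [tmSign]

lemma tmSign_two_mul (n : ℕ) : tmSign (2 * n) = tmSign n := by
  rcases Nat.eq_zero_or_pos n with rfl | hn
  · rfl
  · simp [tmSign, Nat.digits_def' one_lt_two (show 0 < 2 * n by omega)]

lemma tmSign_two_mul_add_one (n : ℕ) : tmSign (2 * n + 1) = -tmSign n := by
  have h : (2 * n + 1) / 2 = n := by omega
  have h' : (2 * n + 1) % 2 = 1 := by omega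
  rw [tmSign, Nat.digits_def' one_lt_two (show 0 < 2 * n + 1 by omega), h, h']
  simp [tmSign, pow_add]

lemma tmSign_eq_div_two (n : ℕ) : tmSign n = (if Even n then 1 else -1) * tmSign (n / 2) := by
  rcases Nat.even_or_odd' n with ⟨k, rfl | rfl⟩
  · simp [tmSign_two_mul]
  · have h : (2 * k + 1) / 2 = k := by omega
    simp [tmSign_two_mul_add_one, h]

lemma tmSign_eq_or (n : ℕ) : tmSign n = 1 ∨ tmSign n = -1 := neg_one_pow_eq_or ℤ _

lemma mem_TMA_iff (n : ℕ) : n ∈ TMA ↔ tmSign n = 1 := by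
  rw [TMA, Set.mem_ofPred_eq, tmSign, neg_one_pow_eq_one_iff_even (by norm_num)]

lemma mem_TMB_iff (n : ℕ) : n ∈ TMB ↔ tmSign n = -1 := by
  have h : n ∈ TMB ↔ ¬ n ∈ TMA := Iff.rfl
  rw [h, mem_TMA_iff]
  rcases tmSign_eq_or n with h | h <;> rw [h] <;> norm_num

lemma tmSign_two_pow_add (k n : ℕ) (hn : n < 2 ^ k) : tmSign (2 ^ k + n) = -tmSign n := by
  induction k generalizing n with
  | zero =>
    obtain rfl : n = 0 := by simpa using hn
    simpa using tmSign_two_mul_add_one 0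
  | succ k ih =>
    rw [pow_succ] at hn ⊢
    rcases Nat.even_or_odd' n with ⟨m, rfl | rfl⟩
    · rw [show 2 ^ k * 2 + 2 * m = 2 * (2 ^ k + m) by ring, tmSign_two_mul, tmSign_two_mul,
        ih m (by omega)]
    · rw [show 2 ^ k * 2 + (2 * m + 1) = 2 * (2 ^ k + m) + 1 by ring, tmSign_two_mul_add_one,
        tmSign_two_mul_add_one, ih m (by omega)]

lemma tmSign_two_pow_sub_one (k : ℕ) : tmSign (2 ^ k - 1) = (-1) ^ k := by
  induction k with
  | zero => exact tmSign_zero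
  | succ k ih =>
    have := Nat.two_pow_pos k
    rw [show 2 ^ (k + 1) - 1 = 2 * (2 ^ k - 1) + 1 by rw [pow_succ]; omega,
      tmSign_two_mul_add_one, ih, pow_succ]
    ring

lemma signRec_tmDiff (l : ℕ) (hl : 0 < l) :
    SignRec (2 ^ (2 * l + 1) - 2) (3 * 2 ^ (2 * l + 1) - 4) (tmDiff (2 ^ (2 * l + 1))) := by
  obtain ⟨j, rfl⟩ : ∃ j, l = j + 1 := ⟨l - 1, by omega⟩
  have hK := Nat.two_pow_pos (2 * j + 1)
  have hp1 : 2 ^ (2 * j + 2) = 2 * 2 ^ (2 * j + 1) := by ring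
  have hp2 : 2 ^ (2 * (j + 1) + 1) = 4 * 2 ^ (2 * j + 1) := by ring
  have hpow : 2 ≤ 2 ^ (2 * j + 1) := by
    rw [pow_succ]; have := Nat.two_pow_pos (2 * j); omega
  have hadd := tmSign_two_pow_add (2 * (j + 1) + 1)
  have hhalf := tmSign_two_pow_add (2 * j + 2) 0 (by positivity)
  have h1 := tmSign_two_pow_sub_one (2 * j + 1)
  rw [Odd.neg_one_pow ⟨j, rfl⟩] at h1
  rw [add_zero, tmSign_zero, hp1] at hhalf
  rw [hp2] at hadd ⊢
  generalize 2 ^ (2 * j + 1) = K at *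
  have hm2 : tmSign (2 * K - 1) = 1 := by
    rw [show 2 * K - 1 = 2 * (K - 1) + 1 by omega, tmSign_two_mul_add_one, h1]; norm_num
  have hm2' : tmSign (2 * K - 2) = -1 := by
    rw [show 2 * K - 2 = 2 * (K - 1) by omega, tmSign_two_mul, h1]
  have hN1 : tmSign (4 * K - 1) = -1 := by
    rw [show 4 * K - 1 = 2 * (2 * K - 1) + 1 by omega, tmSign_two_mul_add_one, hm2]
  have hN2 : tmSign (4 * K - 2) = 1 := by
    rw [show 4 * K - 2 = 2 * (2 * K - 1) by omega, tmSign_two_mul, hm2]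
  have hN3 : tmSign (4 * K - 3) = 1 := by
    rw [show 4 * K - 3 = 2 * (2 * K - 2) + 1 by omega, tmSign_two_mul_add_one, hm2']; norm_num
  have hN4 : tmSign (4 * K - 4) = -1 := by
    rw [show 4 * K - 4 = 2 * (2 * K - 2) by omega, tmSign_two_mul, hm2']
  have t1 : tmSign 1 = -1 := by simp [tmSign]
  have t2 : tmSign 2 = -1 := by simp [tmSign]
  have t3 : tmSign 3 = 1 := by simp [tmSign]
  have d1 (n : ℕ) (h : n < 4 * K - 2) : tmDiff (4 * K) n = tmSign n := by
    rw [tmDiff, if_pos h]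
  have d2 (n : ℕ) (h : 4 * K - 2 ≤ n) (h' : n < 4 * K) : tmDiff (4 * K) n = 0 := by
    rw [tmDiff, if_neg (by omega), if_pos h']
  have d3 (n : ℕ) (h : 2 ≤ n) (h' : n < 4 * K) :
      tmDiff (4 * K) (4 * K - 2 + n) = -tmSign n := by
    rw [tmDiff, if_neg (by omega), if_neg (by omega), if_pos (by omega), Nat.add_sub_cancel_left]
  have d4 (n : ℕ) (h : n < 4 * K - 2) :
      tmDiff (4 * K) (8 * K - 2 + n) = -tmSign n := by
    rw [tmDiff, if_neg (by omega), if_neg (by omega), if_neg (by omega), if_pos (by omega)]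
    congr 2; omega
  have d5 : tmDiff (4 * K) (12 * K - 4) = 1 := by
    rw [tmDiff, if_neg (by omega), if_neg (by omega), if_neg (by omega), if_neg (by omega)]
  intro n hn hnM
  rcases lt_or_ge n (4 * K) with hA | hA
  · rw [d1 (n / 2) (by omega), ← tmSign_eq_div_two, shiftSeq, shiftSeq,
      if_neg (c := 4 * K - 2 + 2 ≤ n) (by omega)]
    rcases lt_or_ge n (4 * K - 2) with hB | hB
    · rw [if_neg (by omega), d1 n hB]; ring
    · rw [if_pos hB, d2 n hB hA, d1 _ (by omega)]
      obtain rfl | rfl : n = 4 * K - 2 ∨ n = 4 * K - 1 := by omega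
      · rw [Nat.sub_self, tmSign_zero, hN2]; ring
      · rw [show 4 * K - 1 - (4 * K - 2) = 1 by omega, t1, hN1]; ring
  rw [shiftSeq, shiftSeq, if_pos (by omega), if_pos (by omega)]
  rcases lt_or_ge n (8 * K - 2) with hB | hB
  · obtain ⟨m, rfl⟩ : ∃ m, n = 4 * K + m := ⟨n - 4 * K, by omega⟩
    rw [show 4 * K + m - (4 * K - 2) = m + 2 by omega,
      show 4 * K + m - (4 * K - 2 + 2) = m by omega, d1 m (by omega),
      show 4 * K + m = 4 * K - 2 + (m + 2) by omega, d3 (m + 2) (by omega) (by omega),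
      show 4 * K - 2 + (m + 2) = 4 * K + m by omega]
    rcases lt_or_ge m (4 * K - 4) with hC | hC
    · rw [d1 (m + 2) (by omega), d1 _ (by omega), ← tmSign_eq_div_two, hadd m (by omega)]; ring
    · rw [d2 (m + 2) (by omega) (by omega), d2 _ (by omega) (by omega)]
      obtain rfl | rfl : m = 4 * K - 4 ∨ m = 4 * K - 3 := by omega
      · rw [hN4, show 4 * K - 4 + 2 = 4 * K - 2 by omega, hN2]; ring
      · rw [hN3, show 4 * K - 3 + 2 = 4 * K - 1 by omega, hN1]; ring
  rcases lt_or_ge n (12 * K - 4) with hC | hC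
  · obtain ⟨m, rfl⟩ : ∃ m, n = 8 * K - 2 + m := ⟨n - (8 * K - 2), by omega⟩
    rw [d4 m (by omega), show 8 * K - 2 + m - (4 * K - 2) = 4 * K - 2 + (m + 2) by omega,
      d3 (m + 2) (by omega) (by omega),
      show 8 * K - 2 + m - (4 * K - 2 + 2) = 4 * K - 2 + m by omega]
    rcases lt_or_ge m 2 with hD | hD
    · rw [d2 (4 * K - 2 + m) (by omega) (by omega), d2 _ (by omega) (by omega)]
      interval_cases m
      · rw [tmSign_zero, t2]; ring
      · rw [t1, t3]; ring
    · have hev : Even (8 * K - 2 + m) ↔ Even (m + 2) := by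
        rw [Nat.even_iff, Nat.even_iff]; omega
      rw [d3 m hD (by omega), tmSign_eq_div_two (m + 2),
        show (8 * K - 2 + m) / 2 = 4 * K - 2 + (m + 2) / 2 by omega,
        d3 _ (by omega) (by omega)]
      simp only [hev]
      ring
  · obtain rfl : n = 12 * K - 4 := by omega
    rw [d5, show 12 * K - 4 - (4 * K - 2) = 8 * K - 2 + 0 by omega, d4 0 (by omega),
      show 12 * K - 4 - (4 * K - 2 + 2) = 4 * K - 2 + (4 * K - 2) by omega,
      d3 _ (by omega) (by omega), show (12 * K - 4) / 2 = 4 * K - 2 + 2 * K by omega,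
      d3 _ (by omega) (by omega), if_pos (by rw [Nat.even_iff]; omega), hhalf, hN2, tmSign_zero]
    ring

lemma SignRec.unique {a M : ℕ} (ha : 0 < a) {f g : ℕ → ℤ} (hf : SignRec a M f)
    (hg : SignRec a M g) (h0 : f 0 = g 0) : ∀ n ≤ M, f n = g n := by
  intro n
  induction n using Nat.strong_induction_on with
  | _ n ih =>
    intro hn
    rcases Nat.eq_zero_or_pos n with rfl | hpos
    · exact h0
    have hfn := hf n hpos hn
    have hgn := hg n hpos hn
    have e1 : shiftSeq a f n = shiftSeq a g n := by
      unfold shiftSeq; split_ifs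
      · exact ih _ (by omega) (by omega)
      · rfl
    have e2 : shiftSeq (a + 2) f n = shiftSeq (a + 2) g n := by
      unfold shiftSeq; split_ifs
      · exact ih _ (by omega) (by omega)
      · rfl
    rw [ih (n / 2) (by omega) (by omega), ← hgn, e1, e2] at hfn
    linarith

lemma SignRec.congr {a M : ℕ} {f g : ℕ → ℤ} (hf : SignRec a M f)
    (h : ∀ n ≤ M, f n = g n) : SignRec a M g := by
  intro n hn hnM
  have e (k : ℕ) : shiftSeq k g n = shiftSeq k f n := by
    unfold shiftSeq; split_ifs
    · exact (h _ (by omega)).symm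
    · rfl
  rw [e, e, ← h n hnM, ← h (n / 2) (by omega)]
  exact hf n hn hnM

lemma mem_add_image_iff (c n : ℕ) (S : Set ℕ) :
    n ∈ (fun x => c + x) '' S ↔ c ≤ n ∧ n - c ∈ S := by
  constructor
  · rintro ⟨x, hx, rfl⟩
    exact ⟨Nat.le_add_right c x, by simpa using hx⟩
  · rintro ⟨h, hx⟩
    exact ⟨n - c, hx, by simp only; omega⟩

lemma tmSign_two_pow_odd_sub (l : ℕ) :
    tmSign (2 ^ (2 * l + 1) - 2) = 1 ∧ tmSign (2 ^ (2 * l + 1) - 1) = -1 := by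
  constructor
  · rw [show 2 ^ (2 * l + 1) - 2 = 2 * (2 ^ (2 * l) - 1) by rw [pow_succ]; omega,
      tmSign_two_mul, tmSign_two_pow_sub_one]
    simp
  · rw [tmSign_two_pow_sub_one, Odd.neg_one_pow ⟨l, rfl⟩]

lemma mem_Eset_iff (l : ℕ) (hl : 0 < l) (n : ℕ) : n ∈ Eset l ↔
    n = 2 ^ (2 * l + 1) - 2 ∨ n = 2 ^ (2 * l + 1) - 1 ∨
      (n ≤ 3 * 2 ^ (2 * l + 1) - 4 ∧ tmDiff (2 ^ (2 * l + 1)) n = 1) := by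
  have hN : 4 < 2 ^ (2 * l + 1) :=
    lt_of_lt_of_le (by norm_num) (Nat.pow_le_pow_right two_pos (show 3 ≤ 2 * l + 1 by omega))
  have h2 := (tmSign_two_pow_odd_sub l).1
  have t1 : tmSign 1 = -1 := by simp [tmSign]
  simp only [Eset, TMAl, TMBl, Set.mem_union, mem_add_image_iff, Set.mem_inter_iff, mem_TMA_iff,
    mem_TMB_iff, Set.mem_Icc, Set.mem_singleton_iff, tmDiff,
    show 2 ^ (2 * l + 2) = 2 * 2 ^ (2 * l + 1) by ring]
  generalize 2 ^ (2 * l + 1) = N at *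
  by_cases hn2 : n = N - 2
  · subst hn2; exact iff_of_true (Or.inl (Or.inl (Or.inl ⟨h2, by omega, by omega⟩))) (Or.inl rfl)
  by_cases hn1 : n = N - 1
  · subst hn1
    have e : N - 1 - (N - 2) = 1 := by omega
    exact iff_of_true (Or.inl (Or.inl (Or.inr ⟨by omega, by rw [e, t1], by omega, by omega⟩)))
      (Or.inr (Or.inl rfl))
  split_ifs <;> omega

lemma mem_Fset_iff (l : ℕ) (hl : 0 < l) (n : ℕ) : n ∈ Fset l ↔
    n = 2 ^ (2 * l + 1) - 2 ∨ n = 2 ^ (2 * l + 1) - 1 ∨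
      (n ≤ 3 * 2 ^ (2 * l + 1) - 4 ∧ tmDiff (2 ^ (2 * l + 1)) n = -1) := by
  have hN : 4 < 2 ^ (2 * l + 1) :=
    lt_of_lt_of_le (by norm_num) (Nat.pow_le_pow_right two_pos (show 3 ≤ 2 * l + 1 by omega))
  have h1 := (tmSign_two_pow_odd_sub l).2
  have t0 := tmSign_zero
  simp only [Fset, TMAl, TMBl, Set.mem_union, mem_add_image_iff, Set.mem_inter_iff, mem_TMA_iff,
    mem_TMB_iff, Set.mem_Icc, tmDiff, show 2 ^ (2 * l + 2) = 2 * 2 ^ (2 * l + 1) by ring]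
  generalize 2 ^ (2 * l + 1) = N at *
  by_cases hn2 : n = N - 2
  · subst hn2
    exact iff_of_true
      (Or.inl (Or.inr ⟨le_rfl, by rw [Nat.sub_self, t0], by omega, by omega⟩)) (Or.inl rfl)
  by_cases hn1 : n = N - 1
  · subst hn1
    exact iff_of_true (Or.inl (Or.inl ⟨h1, by omega, by omega⟩)) (Or.inr (Or.inl rfl))
  split_ifs <;> (try simp only [and_false, or_false]) <;> omega

open scoped Classical in
lemma two_mul_R (S : Set ℕ) (n : ℕ) : 2 * (R S n : ℤ) =
    ∑ i ∈ Finset.range (n + 1), charFun S i * charFun S (n - i) -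
      if Even n then charFun S (n / 2) else 0 := by
  have hR : (R S n : ℤ) = ∑ i ∈ Finset.range (n + 1),
      if i < n - i then charFun S i * charFun S (n - i) else 0 := by
    have hset : {p : ℕ × ℕ | p.1 ∈ S ∧ p.2 ∈ S ∧ p.1 < p.2 ∧ p.1 + p.2 = n} =
        (fun i => (i, n - i)) '' ((Finset.range (n + 1)).filter
          (fun i => i ∈ S ∧ n - i ∈ S ∧ i < n - i) : Finset ℕ) := by
      ext ⟨x, y⟩
      simp only [Set.mem_ofPred_eq, Set.mem_image, Finset.coe_filter, Finset.mem_range,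
        Prod.mk.injEq]
      constructor
      · rintro ⟨hx, hy, hxy, rfl⟩
        exact ⟨x, ⟨by omega, hx, by simpa using hy, by omega⟩, rfl, by omega⟩
      · rintro ⟨i, ⟨hi, hx, hy, hxy⟩, rfl, rfl⟩
        exact ⟨hx, hy, hxy, by omega⟩
    rw [R, hset, Set.ncard_image_of_injective _ (fun i j h => (Prod.mk.inj h).1),
      Set.ncard_coe_finset, Finset.card_filter]
    push_cast
    refine Finset.sum_congr rfl fun i _ => ?_
    unfold charFun
    by_cases h1 : i ∈ S <;> by_cases h2 : n - i ∈ S <;> simp [h1, h2]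
  have hR' : (R S n : ℤ) = ∑ i ∈ Finset.range (n + 1),
      if n - i < i then charFun S i * charFun S (n - i) else 0 := by
    rw [hR, ← Finset.sum_range_reflect]
    refine Finset.sum_congr rfl fun i hi => ?_
    have hi' : i ≤ n := by simpa [Nat.lt_succ_iff] using hi
    rw [show n + 1 - 1 - i = n - i by omega, Nat.sub_sub_self hi', mul_comm]
  have hD : (if Even n then charFun S (n / 2) else 0) = ∑ i ∈ Finset.range (n + 1),
      if i = n - i then charFun S i * charFun S (n - i) else 0 := by
    by_cases hn : Even n
    · rw [if_pos hn, Finset.sum_eq_single (n / 2)]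
      · rw [Nat.even_iff] at hn
        rw [show n - n / 2 = n / 2 by omega, if_pos rfl, charFun]
        split_ifs <;> simp
      · intro i hi hne
        rw [Finset.mem_range] at hi
        rw [if_neg (by omega)]
      · intro h
        exact absurd (Finset.mem_range.2 (by omega)) h
    · rw [if_neg hn, Finset.sum_eq_zero]
      intro i hi
      rw [Nat.even_iff] at hn
      rw [Finset.mem_range] at hi
      rw [if_neg (by omega)]
  rw [two_mul]
  nth_rw 2 [hR']
  rw [hR, hD, ← Finset.sum_add_distrib, ← Finset.sum_sub_distrib]
  refine Finset.sum_congr rfl fun i _ => ?_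
  rcases lt_trichotomy i (n - i) with h | h | h
  · simp [h, h.ne, h.not_gt]
  · simp [← h]
  · simp [h, h.ne', h.not_gt]

lemma charFun_add_charFun {a M : ℕ} {E F : Set ℕ} (hU : E ∪ F = Set.Icc 0 M)
    (hI : E ∩ F = {a, a + 1}) (n : ℕ) (hn : n ≤ M) :
    charFun E n + charFun F n = 1 + (if n = a then 1 else 0) + if n = a + 1 then 1 else 0 := by
  have h1 : n ∈ E ∨ n ∈ F := by
    have : n ∈ E ∪ F := hU ▸ ⟨Nat.zero_le n, hn⟩
    exact this
  have h2 : (n ∈ E ∧ n ∈ F) ↔ (n = a ∨ n = a + 1) := by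
    have : n ∈ E ∩ F ↔ n ∈ ({a, a + 1} : Set ℕ) := by rw [hI]
    simpa using this
  unfold charFun
  by_cases hE : n ∈ E <;> by_cases hF : n ∈ F <;> by_cases ha : n = a <;>
    by_cases hb : n = a + 1 <;> simp_all

lemma sum_ite_sub_eq (f : ℕ → ℤ) (n a : ℕ) :
    ∑ i ∈ Finset.range (n + 1), f i * (if n - i = a then 1 else 0) = shiftSeq a f n := by
  unfold shiftSeq
  split_ifs with h
  · rw [Finset.sum_eq_single (n - a)]
    · simp [Nat.sub_sub_self h]
    · intro i hi hne
      rw [Finset.mem_range] at hi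
      rw [if_neg (by omega), mul_zero]
    · intro h
      exact absurd (Finset.mem_range.2 (by omega)) h
  · refine Finset.sum_eq_zero fun i hi => ?_
    rw [if_neg (by omega), mul_zero]

lemma two_mul_R_sub_R {a M : ℕ} {E F : Set ℕ} (hU : E ∪ F = Set.Icc 0 M)
    (hI : E ∩ F = {a, a + 1}) (n : ℕ) (hn : n ≤ M) :
    2 * ((R E n : ℤ) - R F n) = ∑ i ∈ Finset.range (n + 1), charDiff E F i +
      shiftSeq a (charDiff E F) n + shiftSeq (a + 1) (charDiff E F) n -
      if Even n then charDiff E F (n / 2) else 0 := by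
  have key : ∑ i ∈ Finset.range (n + 1), charDiff E F i * (charFun E (n - i) + charFun F (n - i))
      = ∑ i ∈ Finset.range (n + 1), charFun E i * charFun E (n - i) -
        ∑ i ∈ Finset.range (n + 1), charFun F i * charFun F (n - i) := by
    have hsymm : ∑ i ∈ Finset.range (n + 1), charFun E i * charFun F (n - i) =
        ∑ i ∈ Finset.range (n + 1), charFun F i * charFun E (n - i) := by
      rw [← Finset.sum_range_reflect]
      refine Finset.sum_congr rfl fun i hi => ?_
      have hi' : i ≤ n := by simpa [Nat.lt_succ_iff] using hi
      rw [show n + 1 - 1 - i = n - i by omega, Nat.sub_sub_self hi', mul_comm]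
    simp only [charDiff, sub_mul, mul_add, Finset.sum_sub_distrib, Finset.sum_add_distrib, hsymm]
    ring
  have key' : ∑ i ∈ Finset.range (n + 1),
      charDiff E F i * (charFun E (n - i) + charFun F (n - i)) =
      ∑ i ∈ Finset.range (n + 1), charDiff E F i +
      shiftSeq a (charDiff E F) n + shiftSeq (a + 1) (charDiff E F) n := by
    rw [← sum_ite_sub_eq, ← sum_ite_sub_eq, ← Finset.sum_add_distrib, ← Finset.sum_add_distrib]
    refine Finset.sum_congr rfl fun i hi => ?_
    rw [charFun_add_charFun hU hI (n - i) (by omega)]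
    ring
  rw [mul_sub, two_mul_R, two_mul_R, ← key', key]
  unfold charDiff
  split_ifs <;> ring

lemma forall_R_eq_iff_signRec {a M : ℕ} (ha : 0 < a) {E F : Set ℕ} (hU : E ∪ F = Set.Icc 0 M)
    (hI : E ∩ F = {a, a + 1}) :
    (∀ n ≤ M, R E n = R F n) ↔ SignRec a M (charDiff E F) := by
  have hstep (n : ℕ) (hn : n + 1 ≤ M) :
      2 * ((R E (n + 1) : ℤ) - R F (n + 1)) - 2 * ((R E n : ℤ) - R F n) =
        charDiff E F (n + 1) + shiftSeq a (charDiff E F) (n + 1) -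
          shiftSeq (a + 2) (charDiff E F) (n + 1) -
          (if Even (n + 1) then 1 else -1) * charDiff E F ((n + 1) / 2) := by
    rw [two_mul_R_sub_R hU hI _ hn, two_mul_R_sub_R hU hI n (by omega), Finset.sum_range_succ]
    have e1 : shiftSeq (a + 1) (charDiff E F) (n + 1) = shiftSeq a (charDiff E F) n := by
      simp [shiftSeq]
    have e2 : shiftSeq (a + 2) (charDiff E F) (n + 1) = shiftSeq (a + 1) (charDiff E F) n := by
      have : n + 1 - (a + 2) = n - (a + 1) := by omega
      simp [shiftSeq, this]
    rw [e1, e2]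
    by_cases h : Even n
    · have h' : ¬ Even (n + 1) := by simpa [Nat.even_add_one] using h
      rw [if_neg h', if_pos h, if_neg h', show (n + 1) / 2 = n / 2 by
        rw [Nat.even_iff] at h; omega]
      ring
    · have h' : Even (n + 1) := by simpa [Nat.even_add_one] using h
      rw [if_pos h', if_neg h, if_pos h']
      ring
  constructor
  · intro h n hn hnM
    obtain ⟨m, rfl⟩ : ∃ m, n = m + 1 := ⟨n - 1, by omega⟩
    have := hstep m hnM
    rw [h _ hnM, h m (by omega)] at this
    linarith
  · intro h n hn
    induction n with
    | zero =>
      have := two_mul_R_sub_R hU hI 0 hn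
      simp only [shiftSeq, if_neg (show ¬ a ≤ 0 by omega)] at this
      simp at this
      omega
    | succ n ih =>
      have h1 := hstep n hn
      have h2 := h (n + 1) (by omega) hn
      rw [ih (by omega)] at h1
      omega

lemma mem_iff_charDiff {a M : ℕ} {E F : Set ℕ} (hU : E ∪ F = Set.Icc 0 M)
    (hI : E ∩ F = {a, a + 1}) (n : ℕ) :
    (n ∈ E ↔ n = a ∨ n = a + 1 ∨ (n ≤ M ∧ charDiff E F n = 1)) ∧
    (n ∈ F ↔ n = a ∨ n = a + 1 ∨ (n ≤ M ∧ charDiff E F n = -1)) := by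
  have h1 : (n ∈ E ∨ n ∈ F) ↔ n ≤ M := by
    have : n ∈ E ∪ F ↔ n ∈ Set.Icc 0 M := by rw [hU]
    simpa using this
  have h2 : (n ∈ E ∧ n ∈ F) ↔ (n = a ∨ n = a + 1) := by
    have : n ∈ E ∩ F ↔ n ∈ ({a, a + 1} : Set ℕ) := by rw [hI]
    simpa using this
  unfold charDiff charFun
  by_cases hE : n ∈ E <;> by_cases hF : n ∈ F <;> simp [hE, hF] at h1 h2 ⊢ <;> omega

theorem stmt_6 (l : ℕ) (hl : 0 < l) (E F : Set ℕ)
    (hU : E ∪ F = Set.Icc 0 (3 * 2 ^ (2 * l + 1) - 4)) (h0 : 0 ∈ E)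
    (hI : E ∩ F = {2 ^ (2 * l + 1) - 2, 2 ^ (2 * l + 1) - 1}) :
    (∀ n ≤ 3 * 2 ^ (2 * l + 1) - 4, R E n = R F n) ↔ (E = Eset l ∧ F = Fset l) := by
  have hN : 4 < 2 ^ (2 * l + 1) :=
    lt_of_lt_of_le (by norm_num) (Nat.pow_le_pow_right two_pos (show 3 ≤ 2 * l + 1 by omega))
  have hEm := mem_Eset_iff l hl
  have hFm := mem_Fset_iff l hl
  have hrec := signRec_tmDiff l hl
  generalize 2 ^ (2 * l + 1) = N at *
  have ha1 : N - 1 = N - 2 + 1 := by omega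
  rw [ha1] at hI hEm hFm
  have hmem := mem_iff_charDiff hU hI
  rw [forall_R_eq_iff_signRec (by omega) hU hI]
  constructor
  · intro h
    have h0F : 0 ∉ F := by
      intro h0F
      have : 0 ∈ E ∩ F := ⟨h0, h0F⟩
      rw [hI] at this
      simp only [Set.mem_insert_iff, Set.mem_singleton_iff] at this
      omega
    have heq := h.unique (by omega) hrec (by
      rw [tmDiff, if_pos (by omega), tmSign_zero]
      simp [charDiff, charFun, h0, h0F])
    constructor <;> ext n
    · rw [(hmem n).1, hEm]
      exact or_congr_right (or_congr_right (and_congr_right fun hn => by rw [heq n hn]))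
    · rw [(hmem n).2, hFm]
      exact or_congr_right (or_congr_right (and_congr_right fun hn => by rw [heq n hn]))
  · rintro ⟨hE, hF⟩
    refine hrec.congr fun n hn => ?_
    have hz (hn : n = N - 2 ∨ n = N - 2 + 1) : tmDiff N n = 0 := by
      rw [tmDiff, if_neg (by omega), if_pos (by omega)]
    have hadd := charFun_add_charFun hU hI n hn
    have h1 := hEm n
    have h2 := hFm n
    rw [← hE] at h1
    rw [← hF] at h2
    unfold charDiff
    unfold charFun at hadd ⊢
    by_cases hnE : n ∈ E <;> by_cases hnF : n ∈ F <;> simp [hnE, hnF] at h1 h2 hadd ⊢ <;>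
      split_ifs at hadd <;> omega
end
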